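/- arXiv:2010.01749 — 3 statements merged into one kernel-verified Lean document; each statement's English description precedes it below -/
import Mathlib

section
/- Let A be a Banach algebra, let ε > 0 and N > 0, and let e, f ∈ A satisfy ‖e‖ ≤ N, ‖f‖ ≤ N, ‖e² − e‖ < ε, and ‖e − f‖ < (ε − ‖e² − e‖)/(2N + 1). Then ‖f² − f‖ < ε. -/
/-- A small perturbation of a quasiidempotent in a Banach algebra is again a
quasiidempotent: if `‖e‖ ≤ N`, `‖f‖ ≤ N`, `‖e² − e‖ < ε` and
`‖e − f‖ < (ε − ‖e² − e‖)/(2N + 1)`, then `‖f² − f‖ < ε`. -/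
theorem quasiIdempotent_perturbation {A : Type*} [NonUnitalNormedRing A]
    [CompleteSpace A] (ε N : ℝ) (hε : 0 < ε) (hN : 0 < N) (e f : A)
    (heN : ‖e‖ ≤ N) (hfN : ‖f‖ ≤ N) (he : ‖e * e - e‖ < ε)
    (hef : ‖e - f‖ < (ε - ‖e * e - e‖) / (2 * N + 1)) :
    ‖f * f - f‖ < ε := by
  rw [lt_div_iff₀ (by positivity)] at hef
  have hdecomp : f * f - f = (e * e - e) + (e - f) - (e * (e - f) + (e - f) * f) := by
    rw [mul_sub, sub_mul]
    abel
  have hleft : ‖e * (e - f)‖ ≤ N * ‖e - f‖ :=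
    (norm_mul_le _ _).trans (by gcongr)
  have hright : ‖(e - f) * f‖ ≤ ‖e - f‖ * N :=
    (norm_mul_le _ _).trans (by gcongr)
  calc ‖f * f - f‖
      ≤ ‖e * e - e‖ + ‖e - f‖ + (‖e * (e - f)‖ + ‖(e - f) * f‖) := by
        rw [hdecomp]
        exact (norm_sub_le _ _).trans (add_le_add (norm_add_le _ _) (norm_add_le _ _))
    _ < ε := by linarith
end

section
/- For n ∈ ℕ, define the polynomial g_n(x) = Σ_{k=0}^{n} (2πi x)^k / k! − (Σ_{k=1}^{n} (2πi)^k / k!)·x². Then for every ε > 0 there exists m ∈ ℕ such that |g_m(x)·g_m(−x) − 1| < ε and |e^{2πi x} − g_m(x)| < 1 for all x ∈ [−2, 2]. -/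
open Complex Finset

/-- The polynomial `g_n(x) = Σ_{k=0}^n (2πi x)^k / k! − (Σ_{k=1}^n (2πi)^k/k!)·x²`. -/
noncomputable def gPoly (n : ℕ) (x : ℂ) : ℂ :=
  ∑ k ∈ Finset.range (n + 1), (2 * Real.pi * Complex.I * x) ^ k / (Nat.factorial k : ℂ) -
    (∑ k ∈ Finset.Icc 1 n, (2 * Real.pi * Complex.I) ^ k / (Nat.factorial k : ℂ)) * x ^ 2

/-- The Taylor polynomials of the complex exponential converge uniformly on closed balls. -/
lemma tendstoUniformlyOn_exp_taylor (R : ℝ) :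
    TendstoUniformlyOn (fun n (z : ℂ) => ∑ k ∈ Finset.range n, z ^ k / (Nat.factorial k : ℂ))
      Complex.exp Filter.atTop (Metric.closedBall 0 R) := by
  have h := tendstoUniformlyOn_tsum_nat (f := fun k (z : ℂ) => z ^ k / (Nat.factorial k : ℂ))
    (Real.summable_pow_div_factorial R) (s := Metric.closedBall 0 R) (fun k z hz => by
      rw [mem_closedBall_zero_iff] at hz
      rw [norm_div, norm_pow, Complex.norm_natCast]
      gcongr)
  refine h.congr_right fun z _ => ?_
  rw [Complex.exp_eq_exp_ℂ]
  exact (NormedSpace.expSeries_div_hasSum_exp z).tsum_eq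

lemma gPoly_eq_sum_range (n : ℕ) (x : ℂ) :
    gPoly n x = ∑ k ∈ Finset.range (n + 1), (2 * Real.pi * I * x) ^ k / (Nat.factorial k : ℂ) -
      (∑ k ∈ Finset.range (n + 1), (2 * Real.pi * I) ^ k / (Nat.factorial k : ℂ) - 1) * x ^ 2 := by
  rw [gPoly, Finset.range_eq_Ico, Finset.sum_eq_sum_Ico_succ_bot (Nat.succ_pos n)
    fun k => (2 * Real.pi * I) ^ k / (Nat.factorial k : ℂ)]
  simp [Finset.Ico_add_one_right_eq_Icc]

lemma exists_gPoly_uniform_approx {δ : ℝ} (hδ : 0 < δ) :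
    ∃ m : ℕ, ∀ x : ℂ, ‖x‖ ≤ 2 → ‖Complex.exp (2 * Real.pi * I * x) - gPoly m x‖ < δ := by
  obtain ⟨N, hN⟩ := Filter.eventually_atTop.1
    (Metric.tendstoUniformlyOn_iff.1 (tendstoUniformlyOn_exp_taylor (4 * Real.pi)) (δ / 5)
      (by positivity))
  refine ⟨N, fun x hx => ?_⟩
  have hpi : ‖2 * (Real.pi : ℂ) * I‖ = 2 * Real.pi := by
    simp [abs_of_pos Real.pi_pos]
  have h₁ := hN (N + 1) (Nat.le_succ N) (2 * Real.pi * I * x) (by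
    rw [mem_closedBall_zero_iff, norm_mul, hpi]
    nlinarith [Real.pi_pos])
  have h₂ := hN (N + 1) (Nat.le_succ N) (2 * Real.pi * I) (by
    rw [mem_closedBall_zero_iff, hpi]
    linarith [Real.pi_pos])
  rw [dist_eq_norm] at h₁
  rw [dist_eq_norm', Complex.exp_two_pi_mul_I] at h₂
  have hx2 : ‖x ^ 2‖ ≤ 4 := by
    rw [norm_pow]
    nlinarith [norm_nonneg x]
  rw [gPoly_eq_sum_range, sub_sub_eq_add_sub, add_sub_right_comm]
  refine (norm_add_le _ _).trans_lt ?_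
  rw [norm_mul]
  nlinarith [mul_le_mul h₂.le hx2 (norm_nonneg _) (by positivity)]

lemma norm_mul_sub_one_lt {a b u v : ℂ} {δ : ℝ} (huv : u * v = 1) (hu : ‖u‖ = 1) (hv : ‖v‖ = 1)
    (ha : ‖u - a‖ < δ) (hb : ‖v - b‖ < δ) (hδ : δ ≤ 1) : ‖a * b - 1‖ < 3 * δ := by
  have key : a * b - 1 = (u - a) * (v - b) - ((u - a) * v + u * (v - b)) := by
    linear_combination huv
  have h := norm_sub_le ((u - a) * (v - b)) ((u - a) * v + u * (v - b))
  have h' := norm_add_le ((u - a) * v) (u * (v - b))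
  rw [norm_mul, norm_mul, hu, hv] at h'
  rw [norm_mul] at h
  rw [key]
  nlinarith [norm_nonneg (u - a), norm_nonneg (v - b)]

/-- For every `ε > 0` there is `m` such that `|g_m(x)·g_m(−x) − 1| < ε` and
`|e^{2πi x} − g_m(x)| < 1` for all `x ∈ [−2, 2]`. -/
theorem gPoly_exists_good_m (ε : ℝ) (hε : 0 < ε) :
    ∃ m : ℕ, ∀ x : ℝ, x ∈ Set.Icc (-2 : ℝ) 2 →
      ‖gPoly m (x : ℂ) * gPoly m (-(x : ℂ)) - 1‖ < ε ∧
      ‖Complex.exp (2 * Real.pi * Complex.I * x) - gPoly m (x : ℂ)‖ < 1 := by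
  obtain ⟨m, hm⟩ := exists_gPoly_uniform_approx (δ := min 1 (ε / 3)) (by positivity)
  have hexp (y : ℝ) : ‖Complex.exp (2 * Real.pi * I * y)‖ = 1 := by
    rw [← Complex.norm_exp_ofReal_mul_I (2 * Real.pi * y)]
    push_cast
    ring_nf
  refine ⟨m, fun x hx => ?_⟩
  have hx2 : ‖(x : ℂ)‖ ≤ 2 := by
    rw [Complex.norm_real]
    exact abs_le.2 hx
  have h₁ := hm x hx2
  have h₂ := hm (-x) (by rwa [norm_neg])
  refine ⟨?_, h₁.trans_le (min_le_left _ _)⟩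
  have h := norm_mul_sub_one_lt (by rw [← Complex.exp_add]; simp) (hexp x)
    (by simpa using hexp (-x)) h₁ h₂ (min_le_left _ _)
  linarith [min_le_right 1 (ε / 3)]
end

section
/- Define h₁: ℝ → ℝ by h₁(t) = (315/151)·∫_ℝ sinc(π(t−s))^8 · sgn(s) ds, where sinc(t) = sin(t)/t for t ≠ 0, sinc(0) = 1, and sgn(s) = 1 for s ≥ 0 and sgn(s) = −1 for s < 0. Then h₁ is well defined (the integrand is integrable for every t), h₁ is an odd function, and h₁(t) → 1 as t → +∞. -/
open MeasureTheory Filter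

/-- `sinc t = sin t / t` for `t ≠ 0`, `sinc 0 = 1`. -/
noncomputable def sinc (t : ℝ) : ℝ := if t = 0 then 1 else Real.sin t / t

/-- `sgn s = 1` for `s ≥ 0`, `sgn s = −1` for `s < 0`. -/
noncomputable def sgn (s : ℝ) : ℝ := if 0 ≤ s then 1 else -1

/-- The normalizing function `h₁(t) = (315/151)·∫ sinc(π(t−s))^8 sgn(s) ds`. -/
noncomputable def h₁ (t : ℝ) : ℝ :=
  (315 / 151) * ∫ s : ℝ, sinc (Real.pi * (t - s)) ^ 8 * sgn s

theorem sinc_eq_real_sinc : sinc = Real.sinc := rfl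

theorem sinc_neg (x : ℝ) : sinc (-x) = sinc x := Real.sinc_neg x

theorem abs_sinc_pi_mul_pow_le {n : ℕ} (hn : 2 ≤ n) (x : ℝ) :
    |sinc (Real.pi * x) ^ n| ≤ 2 * (1 + x ^ 2)⁻¹ := by
  have h1 : |sinc (Real.pi * x)| ≤ 1 := Real.abs_sinc_le_one _
  have h2 : |sinc (Real.pi * x)| ^ n ≤ sinc (Real.pi * x) ^ 2 := by
    rw [← sq_abs]
    exact pow_le_pow_of_le_one (abs_nonneg _) h1 hn
  have h3 : sinc (Real.pi * x) ^ 2 ≤ 1 := by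
    rw [← sq_abs]
    exact pow_le_one₀ (abs_nonneg _) h1
  have h4 : x * Real.pi * sinc (Real.pi * x) = Real.sin (Real.pi * x) := by
    rcases eq_or_ne x 0 with rfl | hx
    · simp
    · have : Real.pi * x ≠ 0 := mul_ne_zero Real.pi_ne_zero hx
      rw [sinc, if_neg this]
      field_simp
  have h5 : (x * sinc (Real.pi * x)) ^ 2 ≤ 1 := by
    have h6 : (x * sinc (Real.pi * x)) ^ 2 * Real.pi ^ 2 ≤ 1 := by
      calc (x * sinc (Real.pi * x)) ^ 2 * Real.pi ^ 2
          = (x * Real.pi * sinc (Real.pi * x)) ^ 2 := by ring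
        _ ≤ 1 := by rw [h4]; exact Real.sin_sq_le_one _
    nlinarith [Real.pi_gt_three, sq_nonneg (x * sinc (Real.pi * x))]
  rw [abs_pow, ← div_eq_mul_inv, le_div_iff₀ (by positivity)]
  nlinarith [sq_nonneg x]

theorem continuous_sinc_pi_mul_pow (n : ℕ) :
    Continuous fun x : ℝ => sinc (Real.pi * x) ^ n := by
  rw [sinc_eq_real_sinc]
  exact (Real.continuous_sinc.comp (by fun_prop)).pow n

theorem integrable_sinc_pi_mul_pow {n : ℕ} (hn : 2 ≤ n) :
    Integrable fun x : ℝ => sinc (Real.pi * x) ^ n :=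
  (integrable_inv_one_add_sq.const_mul 2).mono'
    (continuous_sinc_pi_mul_pow n).aestronglyMeasurable
    (Eventually.of_forall (abs_sinc_pi_mul_pow_le hn))

/-- The even truncated cubic `(m - |x|)₊ ^ 3`. -/
noncomputable def truncCubic (m x : ℝ) : ℝ := max (m - |x|) 0 ^ 3

theorem continuous_truncCubic (m : ℝ) : Continuous (truncCubic m) := by
  unfold truncCubic; fun_prop

theorem truncCubic_neg (m x : ℝ) : truncCubic m (-x) = truncCubic m x := by
  simp [truncCubic]

theorem truncCubic_of_le {m x : ℝ} (h : m ≤ |x|) : truncCubic m x = 0 := by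
  simp [truncCubic, max_eq_right (sub_nonpos.2 h)]

theorem truncCubic_of_mem {m x : ℝ} (h0 : 0 ≤ x) (h : x ≤ m) :
    truncCubic m x = (m - x) ^ 3 := by
  rw [truncCubic, abs_of_nonneg h0, max_eq_left (sub_nonneg.2 h)]

theorem hasCompactSupport_truncCubic (m : ℝ) : HasCompactSupport (truncCubic m) := by
  refine HasCompactSupport.intro (isCompact_closedBall 0 m) fun x hx => truncCubic_of_le ?_
  simpa using (not_le.1 (by simpa using hx)).le

theorem integral_eq_two_mul_of_even {g : ℝ → ℝ} {m : ℝ} (hm : 0 ≤ m)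
    (heven : ∀ x, g (-x) = g x) (hsupp : ∀ x, m ≤ |x| → g x = 0) :
    ∫ x, g x = 2 * ∫ x in (0 : ℝ)..m, g x := by
  have habs : ∀ x, g |x| = g x := fun x => by
    rcases abs_choice x with h | h <;> rw [h]
    exact heven x
  rw [← integral_congr_ae (Eventually.of_forall habs), integral_comp_abs,
    intervalIntegral.integral_of_le hm]
  congr 1
  refine setIntegral_eq_of_subset_of_forall_sdiff_eq_zero measurableSet_Ioi
    (fun x hx => hx.1) fun x hx => hsupp x ?_
  have h0 : 0 < x := hx.1
  have : ¬ x ≤ m := fun h => hx.2 ⟨h0, h⟩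
  rw [abs_of_pos h0]
  exact (not_le.1 this).le

theorem integral_cos_mul_truncCubic {a m : ℝ} (ha : a ≠ 0) (hm : 0 ≤ m) :
    ∫ x, Real.cos (a * x) * truncCubic m x =
      6 * m ^ 2 / a ^ 2 - 12 * (1 - Real.cos (a * m)) / a ^ 4 := by
  rw [integral_eq_two_mul_of_even hm (fun x => by simp [truncCubic_neg])
    (fun x hx => by simp [truncCubic_of_le hx])]
  have h1 : ∫ x in (0 : ℝ)..m, Real.cos (a * x) * truncCubic m x =
      ∫ x in (0 : ℝ)..m, Real.cos (a * x) * (m - x) ^ 3 := by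
    refine intervalIntegral.integral_congr fun x hx => ?_
    rw [Set.uIcc_of_le hm] at hx
    simp only [truncCubic_of_mem hx.1 hx.2]
  let F : ℝ → ℝ := fun x =>
    ((m - x) ^ 3 / a - 6 * (m - x) / a ^ 3) * Real.sin (a * x) +
      (6 / a ^ 4 - 3 * (m - x) ^ 2 / a ^ 2) * Real.cos (a * x)
  have hF : ∀ x, HasDerivAt F (Real.cos (a * x) * (m - x) ^ 3) x := fun x => by
    have hs : HasDerivAt (fun x => m - x) (-1) x := by
      simpa using (hasDerivAt_id x).const_sub m
    have hax : HasDerivAt (fun x => a * x) a x := by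
      simpa using (hasDerivAt_id x).const_mul a
    convert! ((((hs.pow 3).div_const a).sub ((hs.const_mul 6).div_const (a ^ 3))).mul hax.sin).add
      ((((hs.pow 2).const_mul 3).div_const (a ^ 2)).const_sub (6 / a ^ 4) |>.mul hax.cos) using 1
    simp only [Pi.pow_apply, Pi.sub_apply]
    push_cast
    field_simp
    ring
  rw [h1, intervalIntegral.integral_eq_sub_of_hasDerivAt (fun x _ => hF x)
    (Continuous.intervalIntegrable (by fun_prop) _ _)]
  simp only [F]
  simp
  field_simp
  ring

/-- The centred cubic B-spline. -/
noncomputable def cubicBSpline (x : ℝ) : ℝ := (truncCubic 2 x - 4 * truncCubic 1 x) / 6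

theorem continuous_cubicBSpline : Continuous cubicBSpline := by
  have h1 := continuous_truncCubic 1
  have h2 := continuous_truncCubic 2
  unfold cubicBSpline
  fun_prop

theorem cubicBSpline_neg (x : ℝ) : cubicBSpline (-x) = cubicBSpline x := by
  simp [cubicBSpline, truncCubic_neg]

theorem cubicBSpline_of_two_le {x : ℝ} (h : 2 ≤ |x|) : cubicBSpline x = 0 := by
  rw [cubicBSpline, truncCubic_of_le h, truncCubic_of_le (by linarith)]
  norm_num

theorem hasCompactSupport_cubicBSpline : HasCompactSupport cubicBSpline := by
  refine HasCompactSupport.intro (isCompact_closedBall 0 2) fun x hx => cubicBSpline_of_two_le ?_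
  simpa using (not_le.1 (by simpa using hx)).le

theorem integral_cubicBSpline_sq : ∫ x, cubicBSpline x ^ 2 = 151 / 315 := by
  rw [integral_eq_two_mul_of_even zero_le_two (fun x => by rw [cubicBSpline_neg])
    (fun x hx => by simp [cubicBSpline_of_two_le hx])]
  have hc : Continuous fun x => cubicBSpline x ^ 2 := continuous_cubicBSpline.pow 2
  rw [← intervalIntegral.integral_add_adjacent_intervals (b := 1)
    (hc.intervalIntegrable _ _) (hc.intervalIntegrable _ _)]
  have h1 : ∫ x in (0 : ℝ)..1, cubicBSpline x ^ 2 =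
      ∫ x in (0 : ℝ)..1, (4 / 9 - 4 / 3 * x ^ 2 + 2 / 3 * x ^ 3 + x ^ 4 - x ^ 5 + x ^ 6 / 4) := by
    refine intervalIntegral.integral_congr fun x hx => ?_
    rw [Set.uIcc_of_le zero_le_one] at hx
    simp only [cubicBSpline]
    rw [truncCubic_of_mem hx.1 (hx.2.trans one_le_two), truncCubic_of_mem hx.1 hx.2]
    ring
  have h2 : ∫ x in (1 : ℝ)..2, cubicBSpline x ^ 2 = ∫ x in (1 : ℝ)..2, (2 - x) ^ 6 / 36 := by
    refine intervalIntegral.integral_congr fun x hx => ?_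
    rw [Set.uIcc_of_le one_le_two] at hx
    have h0 : 0 ≤ x := zero_le_one.trans hx.1
    simp only [cubicBSpline]
    rw [truncCubic_of_mem h0 hx.2, truncCubic_of_le (hx.1.trans (le_abs_self x))]
    ring
  have h3 : ∫ x in (0 : ℝ)..1,
      (4 / 9 - 4 / 3 * x ^ 2 + 2 / 3 * x ^ 3 + x ^ 4 - x ^ 5 + x ^ 6 / 4) = 151 / 630 - 1 / 252 := by
    let F : ℝ → ℝ := fun x => 4 / 9 * x - 4 / 9 * x ^ 3 + 1 / 6 * x ^ 4 + x ^ 5 / 5 - x ^ 6 / 6 +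
      x ^ 7 / 28
    have hF : ∀ x, HasDerivAt F
        (4 / 9 - 4 / 3 * x ^ 2 + 2 / 3 * x ^ 3 + x ^ 4 - x ^ 5 + x ^ 6 / 4) x := fun x => by
      have hp := fun n : ℕ => hasDerivAt_pow n x
      convert! ((((((hasDerivAt_id x).const_mul (4 / 9)).sub ((hp 3).const_mul (4 / 9))).add
        ((hp 4).const_mul (1 / 6))).add ((hp 5).div_const 5)).sub ((hp 6).div_const 6)).add
        ((hp 7).div_const 28) using 1
      push_cast
      ring
    rw [intervalIntegral.integral_eq_sub_of_hasDerivAt (fun x _ => hF x)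
      (Continuous.intervalIntegrable (by fun_prop) _ _)]
    norm_num [F]
  have h4 : ∫ x in (1 : ℝ)..2, (2 - x) ^ 6 / 36 = 1 / 252 := by
    rw [intervalIntegral.integral_comp_sub_left (fun x => x ^ 6 / 36) 2,
      intervalIntegral.integral_div, integral_pow]
    norm_num
  rw [h1, h2, h3, h4]
  norm_num

theorem integral_cos_mul_cubicBSpline {w : ℝ} (hw : w ≠ 0) :
    ∫ x, Real.cos (2 * Real.pi * w * x) * cubicBSpline x = sinc (Real.pi * w) ^ 4 := by
  have hpw : Real.pi * w ≠ 0 := mul_ne_zero Real.pi_ne_zero hw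
  have ha : 2 * Real.pi * w ≠ 0 := by rw [mul_assoc]; exact mul_ne_zero two_ne_zero hpw
  have hint : ∀ m, Integrable fun x => Real.cos (2 * Real.pi * w * x) * truncCubic m x := fun m =>
    Continuous.integrable_of_hasCompactSupport
      (by have := continuous_truncCubic m; fun_prop) (hasCompactSupport_truncCubic m).mul_left
  have hsplit : ∀ x, Real.cos (2 * Real.pi * w * x) * cubicBSpline x =
      (Real.cos (2 * Real.pi * w * x) * truncCubic 2 x -
        4 * (Real.cos (2 * Real.pi * w * x) * truncCubic 1 x)) / 6 := fun x => by
    rw [cubicBSpline]; ring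
  simp_rw [hsplit]
  rw [integral_div, integral_sub (hint 2) ((hint 1).const_mul 4), integral_const_mul,
    integral_cos_mul_truncCubic ha zero_le_two, integral_cos_mul_truncCubic ha zero_le_one,
    sinc, if_neg hpw]
  have h1 : Real.cos (2 * Real.pi * w * 1) = 1 - 2 * Real.sin (Real.pi * w) ^ 2 := by
    rw [show 2 * Real.pi * w * 1 = 2 * (Real.pi * w) by ring, Real.cos_two_mul, Real.cos_sq']
    ring
  have h2 : Real.cos (2 * Real.pi * w * 2) =
      2 * (1 - 2 * Real.sin (Real.pi * w) ^ 2) ^ 2 - 1 := by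
    rw [← h1, ← Real.cos_two_mul]
    congr 1
    ring
  rw [h1, h2]
  have := Real.pi_ne_zero
  field_simp
  ring

open FourierTransform

theorem integrable_cubicBSpline_ofReal : Integrable fun x => (cubicBSpline x : ℂ) :=
  (continuous_cubicBSpline.integrable_of_hasCompactSupport hasCompactSupport_cubicBSpline).ofReal

theorem fourier_cubicBSpline_eq_integral_cos (w : ℝ) :
    𝓕 (fun x => (cubicBSpline x : ℂ)) w =
      ((∫ x, Real.cos (2 * Real.pi * w * x) * cubicBSpline x : ℝ) : ℂ) := by
  have hcos : Integrable fun x => Real.cos (2 * Real.pi * w * x) * cubicBSpline x :=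
    Continuous.integrable_of_hasCompactSupport
      (by have := continuous_cubicBSpline; fun_prop) hasCompactSupport_cubicBSpline.mul_left
  have hsin : Integrable fun x => Real.sin (2 * Real.pi * w * x) * cubicBSpline x :=
    Continuous.integrable_of_hasCompactSupport
      (by have := continuous_cubicBSpline; fun_prop) hasCompactSupport_cubicBSpline.mul_left
  have hodd : ∫ x, Real.sin (2 * Real.pi * w * x) * cubicBSpline x = 0 := by
    have h := integral_neg_eq_self (fun x => Real.sin (2 * Real.pi * w * x) * cubicBSpline x) volume
    simp only [cubicBSpline_neg, mul_neg, Real.sin_neg, neg_mul, integral_neg] at h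
    linarith
  have hpt : ∀ x : ℝ, Complex.exp (((-2 * Real.pi * x * w : ℝ) : ℂ) * Complex.I) •
      (cubicBSpline x : ℂ) =
      ((Real.cos (2 * Real.pi * w * x) * cubicBSpline x : ℝ) : ℂ) -
        Complex.I * ((Real.sin (2 * Real.pi * w * x) * cubicBSpline x : ℝ) : ℂ) := fun x => by
    rw [Complex.exp_mul_I, ← Complex.ofReal_cos, ← Complex.ofReal_sin,
      show -2 * Real.pi * x * w = -(2 * Real.pi * w * x) by ring, Real.cos_neg, Real.sin_neg]
    push_cast
    rw [smul_eq_mul]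
    ring
  rw [Real.fourier_real_eq_integral_exp_smul]
  simp_rw [hpt]
  rw [integral_sub hcos.ofReal (hsin.ofReal.const_mul _), integral_const_mul, integral_complex_ofReal,
    integral_complex_ofReal, hodd]
  simp

theorem fourier_cubicBSpline :
    𝓕 (fun x => (cubicBSpline x : ℂ)) =ᵐ[volume] fun w => ((sinc (Real.pi * w) ^ 4 : ℝ) : ℂ) := by
  filter_upwards [Measure.ae_ne volume (0 : ℝ)] with w hw
  rw [fourier_cubicBSpline_eq_integral_cos, integral_cos_mul_cubicBSpline hw]

theorem integral_sinc_pi_mul_pow_eight : ∫ x, sinc (Real.pi * x) ^ 8 = 151 / 315 := by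
  let f : ℝ → ℂ := fun x => (cubicBSpline x : ℂ)
  have hf : Integrable f := integrable_cubicBSpline_ofReal
  have hFf : Integrable (𝓕 f) :=
    ((integrable_sinc_pi_mul_pow (by norm_num : 2 ≤ 4)).ofReal).congr fourier_cubicBSpline.symm
  have hinv : 𝓕 (𝓕 f) = f := by
    funext x
    have h := congrFun (Continuous.fourierInv_fourier_eq
      (Complex.continuous_ofReal.comp continuous_cubicBSpline) hf hFf) (-x)
    rw [Real.fourierInv_eq_fourier_neg, neg_neg] at h
    exact h.trans (congrArg Complex.ofReal (cubicBSpline_neg x))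
  have hswap : ∫ x, 𝓕 f x • 𝓕 f x = ∫ x, f x • 𝓕 (𝓕 f) x := by
    simpa using! VectorFourier.integral_fourierIntegral_smul_eq_flip (L := innerₗ ℝ)
      Real.continuous_fourierChar continuous_inner hf hFf
  have hleft : ∫ x, 𝓕 f x • 𝓕 f x = ((∫ x, sinc (Real.pi * x) ^ 8 : ℝ) : ℂ) := by
    rw [← integral_complex_ofReal]
    refine integral_congr_ae ?_
    filter_upwards [fourier_cubicBSpline] with x hx
    rw [hx, smul_eq_mul]
    push_cast
    ring
  have hright : ∫ x, f x • 𝓕 (𝓕 f) x = ((∫ x, cubicBSpline x ^ 2 : ℝ) : ℂ) := by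
    rw [hinv, ← integral_complex_ofReal]
    congr 1 with x
    simp [f, sq]
  rw [hleft, hright, integral_cubicBSpline_sq] at hswap
  exact_mod_cast hswap

theorem measurable_sgn : Measurable sgn :=
  Measurable.ite measurableSet_Ici measurable_const measurable_const

theorem abs_sgn (s : ℝ) : |sgn s| = 1 := by
  unfold sgn; split_ifs <;> simp

theorem sgn_neg {s : ℝ} (hs : s ≠ 0) : sgn (-s) = -sgn s := by
  rcases hs.lt_or_gt with h | h
  · rw [sgn, sgn, if_pos (by linarith), if_neg (by linarith), neg_neg]
  · rw [sgn, sgn, if_neg (by linarith), if_pos h.le]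

theorem integral_sinc_pow_mul_sgn_neg (n : ℕ) (t : ℝ) :
    ∫ s, sinc (Real.pi * (-t - s)) ^ n * sgn s =
      -∫ s, sinc (Real.pi * (t - s)) ^ n * sgn s := by
  rw [← integral_neg_eq_self, ← integral_neg]
  refine integral_congr_ae ?_
  filter_upwards [Measure.ae_ne volume (0 : ℝ)] with s hs
  rw [sgn_neg hs, show Real.pi * (-t - -s) = -(Real.pi * (t - s)) by ring, sinc_neg, mul_neg]

theorem tendsto_integral_mul_sgn {g : ℝ → ℝ} (hg : Integrable g) :
    Tendsto (fun t => ∫ s, g (t - s) * sgn s) atTop (nhds (∫ u, g u)) := by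
  have hsub : ∀ t, ∫ s, g (t - s) * sgn s = ∫ u, g u * sgn (t - u) := fun t => by
    rw [← integral_sub_left_eq_self (fun u => g u * sgn (t - u)) volume t]
    simp only [sub_sub_cancel]
  simp_rw [hsub]
  refine tendsto_integral_filter_of_dominated_convergence (fun u => |g u|)
    (Eventually.of_forall fun t => hg.aestronglyMeasurable.mul
      (measurable_sgn.comp (measurable_const.sub measurable_id)).aestronglyMeasurable)
    (Eventually.of_forall fun t => Eventually.of_forall fun u => ?_) hg.abs
    (Eventually.of_forall fun u => ?_)
  · rw [Real.norm_eq_abs, abs_mul, abs_sgn, mul_one]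
  · refine tendsto_const_nhds.congr' ?_
    filter_upwards [eventually_ge_atTop u] with t ht
    rw [sgn, if_pos (sub_nonneg.2 ht), mul_one]

/-- `h₁` is well defined (the integrand is integrable for every `t`), is an odd
function, and satisfies `h₁(t) → 1` as `t → +∞`. -/
theorem h₁_normalizing :
    (∀ t : ℝ, Integrable (fun s : ℝ => sinc (Real.pi * (t - s)) ^ 8 * sgn s)) ∧
      (∀ t : ℝ, h₁ (-t) = -h₁ t) ∧
      Tendsto h₁ atTop (nhds 1) := by
  have hφ := integrable_sinc_pi_mul_pow (by norm_num : 2 ≤ 8)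
  refine ⟨fun t => ?_, fun t => ?_, ?_⟩
  · exact (hφ.comp_sub_left t).mul_bdd (c := 1) measurable_sgn.aestronglyMeasurable
      (Eventually.of_forall fun s => (abs_sgn s).le)
  · rw [h₁, h₁, integral_sinc_pow_mul_sgn_neg, mul_neg]
  · have h := (tendsto_integral_mul_sgn hφ).const_mul (315 / 151)
    rw [integral_sinc_pi_mul_pow_eight] at h
    convert! h using 2
    norm_num
end
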